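/- arXiv:1303.2772 — 7 statements merged into one kernel-verified Lean document; each statement's English description precedes it below -/
import Mathlib

section
/- Define the step function step : ℕ × ℕ → ℕ × ℕ by step(u, v) = (u, v) if u = v, and otherwise step(u, v) = (t', v) if u > v and step(u, v) = (u, t') if u < v, where t' = |u − v| / 2^{ν₂(|u−v|)} is the odd part of |u − v|. Then for all odd positive integers u, v, iterating step exactly ⌊log₂(u + v)⌋ times starting from (u, v) yields the pair (gcd(u, v), gcd(u, v)). In particular, step B3 of the binary Euclidean algorithm is executed at most ⌊lg(u + v)⌋ times and the algorithm correctly computes gcd(u, v). -/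
/-- One step of the binary Euclidean algorithm (steps B1–B3): if the components
are equal do nothing, otherwise replace the larger component by the odd part of
the difference `|u - v|`. -/
def binStep (p : ℕ × ℕ) : ℕ × ℕ :=
  if p.1 = p.2 then p
  else if p.1 > p.2 then
    ((p.1 - p.2) / 2 ^ padicValNat 2 (p.1 - p.2), p.2)
  else
    (p.1, (p.2 - p.1) / 2 ^ padicValNat 2 (p.2 - p.1))

/-- The odd part of the difference of two odd numbers is odd, at most half the difference, and
has the same gcd with the smaller number as the larger one. -/
theorem odd_part_sub {u v : ℕ} (hou : Odd u) (hov : Odd v) (h : v < u) :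
    Odd ((u - v) / 2 ^ padicValNat 2 (u - v)) ∧
      2 * ((u - v) / 2 ^ padicValNat 2 (u - v)) ≤ u - v ∧
      Nat.gcd ((u - v) / 2 ^ padicValNat 2 (u - v)) v = Nat.gcd u v := by
  have hne : u - v ≠ 0 := by omega
  have hmul : 2 ^ padicValNat 2 (u - v) * ((u - v) / 2 ^ padicValNat 2 (u - v)) = u - v :=
    Nat.mul_div_cancel' pow_padicValNat_dvd
  have hval : 1 ≤ padicValNat 2 (u - v) :=
    one_le_padicValNat_of_dvd hne (Nat.Odd.sub_odd hou hov).two_dvd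
  have hnot : ¬ 2 ^ (padicValNat 2 (u - v) + 1) ∣ u - v :=
    pow_succ_padicValNat_not_dvd hne
  generalize padicValNat 2 (u - v) = k at *
  generalize (u - v) / 2 ^ k = m at *
  refine ⟨?_, ?_, ?_⟩
  · rw [← Nat.not_even_iff_odd, even_iff_two_dvd]
    intro hm
    apply hnot
    rw [pow_succ, ← hmul]
    exact Nat.mul_dvd_mul_left _ hm
  · have hk : 2 ^ 1 ≤ 2 ^ k := Nat.pow_le_pow_right (by norm_num) hval
    calc 2 * m ≤ 2 ^ k * m := Nat.mul_le_mul_right m (by simpa using hk)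
      _ = u - v := hmul
  · have hcop : Nat.Coprime (2 ^ k) v := (Nat.coprime_two_left.mpr hov).pow_left k
    rw [← Nat.Coprime.gcd_mul_left_cancel m hcop, hmul, Nat.gcd_sub_self_left h.le]

/-- Once `u + v < 2 ^ (n + 1)`, iterating `n` steps of the algorithm reaches the gcd. -/
theorem binStep_iterate_eq_gcd (n : ℕ) : ∀ {u v : ℕ}, Odd u → Odd v → u + v < 2 ^ (n + 1) →
    binStep^[n] (u, v) = (Nat.gcd u v, Nat.gcd u v) := by
  induction n with
  | zero =>
    intro u v hou hov h
    have := hou.pos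
    have := hov.pos
    omega
  | succ n ih =>
    intro u v hou hov h
    rw [pow_succ] at h
    rw [Function.iterate_succ_apply]
    rcases lt_trichotomy u v with huv | rfl | huv
    · obtain ⟨hodd, hle, hgcd⟩ := odd_part_sub hov hou huv
      have hstep : binStep (u, v) = (u, (v - u) / 2 ^ padicValNat 2 (v - u)) := by
        simp [binStep, huv.ne, huv.le]
      rw [hstep, ih hou hodd (by omega), Nat.gcd_comm u, hgcd, Nat.gcd_comm]
    · have hstep : binStep (u, u) = (u, u) := by simp [binStep]
      rw [hstep, Function.iterate_fixed hstep, Nat.gcd_self]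
    · obtain ⟨hodd, hle, hgcd⟩ := odd_part_sub hou hov huv
      have hstep : binStep (u, v) = ((u - v) / 2 ^ padicValNat 2 (u - v), v) := by
        simp [binStep, huv.ne', huv]
      rw [hstep, ih hodd hov (by omega), hgcd]

/-- For odd positive integers `u, v`, iterating one step of the binary Euclidean
algorithm exactly `⌊log₂ (u + v)⌋` times starting from `(u, v)` yields
`(gcd u v, gcd u v)`: the algorithm performs at most `⌊lg (u + v)⌋` iterations
of step B3 and correctly computes the gcd. -/
theorem binary_euclid_iterate_log (u v : ℕ) (hu : 0 < u) (hv : 0 < v)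
    (hou : Odd u) (hov : Odd v) :
    binStep^[Nat.log 2 (u + v)] (u, v) = (Nat.gcd u v, Nat.gcd u v) := by
  exact binStep_iterate_eq_gcd _ hou hov (Nat.lt_pow_succ_log_self one_lt_two _)
end

section
/- Let f : ℝ → [0, ∞] be a measurable function (with values in the extended nonnegative reals). Then the Lebesgue (lower) integral of B₂[f] over the interval (0, 1) equals the Lebesgue integral of f over (0, 1): ∫_{(0,1)} B₂[f](x) dx = ∫_{(0,1)} f(x) dx. That is, the binary Euclidean operator B₂ preserves the L₁ norm of nonnegative functions on (0, 1). -/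
open scoped ENNReal

/-- The binary Euclidean operator `B₂` acting on nonnegative extended-real-valued
functions: `B₂[f](x) = Σ_{k≥1} ((1/(x+2^k))² f(x/(x+2^k)) + (1/(1+2^k x))² f(1/(1+2^k x)))`. -/
noncomputable def binaryB2 (f : ℝ → ℝ≥0∞) (x : ℝ) : ℝ≥0∞ :=
  ∑' k : ℕ,
    ((ENNReal.ofReal (1 / (x + 2 ^ (k + 1)))) ^ 2 * f (x / (x + 2 ^ (k + 1))) +
     (ENNReal.ofReal (1 / (1 + 2 ^ (k + 1) * x))) ^ 2 * f (1 / (1 + 2 ^ (k + 1) * x)))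

open Set MeasureTheory

lemma image_div_add_Ioo {a : ℝ} (ha : 0 < a) :
    (fun x : ℝ => x / (x + a)) '' Ioo 0 1 = Ioo 0 (1 / (1 + a)) := by
  ext y
  constructor
  · rintro ⟨x, ⟨h0, h1⟩, rfl⟩
    refine ⟨by positivity, ?_⟩
    rw [div_lt_div_iff₀ (by positivity) (by positivity)]
    nlinarith
  · rintro ⟨h0, h1⟩
    rw [lt_div_iff₀ (by positivity)] at h1
    have hy : 0 < 1 - y := by nlinarith
    refine ⟨a * y / (1 - y), ⟨by positivity, ?_⟩, ?_⟩
    · rw [div_lt_one hy]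
      linarith
    · have h : a * y / (1 - y) + a = a / (1 - y) := by
        field_simp
        ring
      simp only [h]
      field_simp

lemma image_one_div_one_add_mul_Ioo {a : ℝ} (ha : 0 < a) :
    (fun x : ℝ => 1 / (1 + a * x)) '' Ioo 0 1 = Ioo (1 / (1 + a)) 1 := by
  ext y
  constructor
  · rintro ⟨x, ⟨h0, h1⟩, rfl⟩
    constructor
    · rw [div_lt_div_iff₀ (by positivity) (by positivity)]
      nlinarith
    · rw [div_lt_one (by positivity)]
      nlinarith [mul_pos ha h0]
  · rintro ⟨h0, h1⟩
    have hy : 0 < y := lt_trans (by positivity) h0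
    rw [div_lt_iff₀ (by positivity)] at h0
    have hy1 : 0 < 1 - y := by linarith
    refine ⟨(1 - y) / (a * y), ⟨by positivity, ?_⟩, ?_⟩
    · rw [div_lt_one (by positivity)]
      linarith
    · have h : 1 + a * ((1 - y) / (a * y)) = 1 / y := by
        field_simp
        ring
      simp only [h, one_div_one_div]

lemma ofReal_one_div_sq_eq {a b : ℝ} (ha : 0 < a) (hb : 0 < b) :
    ENNReal.ofReal (1 / b) ^ 2 = ENNReal.ofReal (1 / a) * ENNReal.ofReal (a / b ^ 2) := by
  rw [← ENNReal.ofReal_pow (by positivity), ← ENNReal.ofReal_mul (by positivity)]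
  congr 1
  field_simp

lemma lintegral_div_add_Ioo {a : ℝ} (ha : 0 < a) (f : ℝ → ℝ≥0∞) :
    ∫⁻ x in Ioo (0 : ℝ) 1, ENNReal.ofReal (1 / (x + a)) ^ 2 * f (x / (x + a)) =
      ENNReal.ofReal (1 / a) * ∫⁻ x in Ioo 0 (1 / (1 + a)), f x := by
  have hderiv : ∀ x ∈ Ioo (0 : ℝ) 1,
      HasDerivWithinAt (fun x : ℝ => x / (x + a)) (a / (x + a) ^ 2) (Ioo 0 1) x := by
    intro x hx
    have hne : x + a ≠ 0 := (add_pos hx.1 ha).ne'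
    have h := (hasDerivAt_id x).div ((hasDerivAt_id x).add_const a) hne
    refine (h.congr_deriv ?_).hasDerivWithinAt
    simp
  have hinj : InjOn (fun x : ℝ => x / (x + a)) (Ioo 0 1) := by
    intro x hx y hy h
    have hx' := add_pos hx.1 ha
    have hy' := add_pos hy.1 ha
    simp only [div_eq_div_iff hx'.ne' hy'.ne'] at h
    exact mul_right_cancel₀ ha.ne' (by linarith)
  rw [← image_div_add_Ioo ha,
    lintegral_image_eq_lintegral_abs_deriv_mul measurableSet_Ioo hderiv hinj,
    ← lintegral_const_mul' _ _ ENNReal.ofReal_ne_top]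
  refine setLIntegral_congr_fun measurableSet_Ioo fun x hx => ?_
  have hx' := add_pos hx.1 ha
  rw [abs_of_pos (by positivity), ofReal_one_div_sq_eq ha hx', mul_assoc]

lemma lintegral_one_div_one_add_mul_Ioo {a : ℝ} (ha : 0 < a) (f : ℝ → ℝ≥0∞) :
    ∫⁻ x in Ioo (0 : ℝ) 1, ENNReal.ofReal (1 / (1 + a * x)) ^ 2 * f (1 / (1 + a * x)) =
      ENNReal.ofReal (1 / a) * ∫⁻ x in Ioo (1 / (1 + a)) 1, f x := by
  have hpos : ∀ x ∈ Ioo (0 : ℝ) 1, 0 < 1 + a * x := fun x hx =>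
    add_pos one_pos (mul_pos ha hx.1)
  have hderiv : ∀ x ∈ Ioo (0 : ℝ) 1,
      HasDerivWithinAt (fun x : ℝ => 1 / (1 + a * x)) (-(a / (1 + a * x) ^ 2)) (Ioo 0 1) x := by
    intro x hx
    have h := (hasDerivAt_const x (1 : ℝ)).div
      (((hasDerivAt_id x).const_mul a).const_add 1) (hpos x hx).ne'
    refine (h.congr_deriv ?_).hasDerivWithinAt
    simp [neg_div]
  have hinj : InjOn (fun x : ℝ => 1 / (1 + a * x)) (Ioo 0 1) := by
    intro x hx y hy h
    simp only [div_eq_div_iff (hpos x hx).ne' (hpos y hy).ne'] at h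
    exact mul_left_cancel₀ ha.ne' (by linarith)
  rw [← image_one_div_one_add_mul_Ioo ha,
    lintegral_image_eq_lintegral_abs_deriv_mul measurableSet_Ioo hderiv hinj,
    ← lintegral_const_mul' _ _ ENNReal.ofReal_ne_top]
  refine setLIntegral_congr_fun measurableSet_Ioo fun x hx => ?_
  have hx' := hpos x hx
  rw [abs_neg, abs_of_pos (by positivity), ofReal_one_div_sq_eq ha hx', mul_assoc]

lemma lintegral_Ioo_add_Ioo {a b c : ℝ} (hab : a < b) (hbc : b < c) (f : ℝ → ℝ≥0∞) :
    (∫⁻ x in Ioo a b, f x) + ∫⁻ x in Ioo b c, f x = ∫⁻ x in Ioo a c, f x := by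
  rw [← Ioc_union_Ioo_eq_Ioo hab.le hbc,
    lintegral_union measurableSet_Ioo (disjoint_left.2 fun x hx hy => hx.2.not_gt hy.1),
    setLIntegral_congr Ioo_ae_eq_Ioc]

lemma tsum_ofReal_one_div_two_pow_succ :
    ∑' k : ℕ, ENNReal.ofReal (1 / 2 ^ (k + 1)) = 1 := by
  rw [← ENNReal.ofReal_tsum_of_nonneg (fun k => by positivity)]
  · have h := tsum_geometric_two' 1
    simp only [div_div, ← pow_succ'] at h
    rw [h, ENNReal.ofReal_one]
  · simpa only [div_div, ← pow_succ'] using summable_geometric_two' 1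

/-- The binary Euclidean operator preserves the `L₁` norm of nonnegative
measurable functions on `(0,1)`:
`∫_{(0,1)} B₂[f] = ∫_{(0,1)} f` (Lebesgue lower integrals in `[0,∞]`). -/
theorem binaryB2_lintegral_preserved (f : ℝ → ℝ≥0∞) (hf : Measurable f) :
    ∫⁻ x in Set.Ioo (0 : ℝ) 1, binaryB2 f x = ∫⁻ x in Set.Ioo (0 : ℝ) 1, f x := by
  simp only [binaryB2]
  rw [lintegral_tsum fun k => by fun_prop]
  have hterm : ∀ k : ℕ, ∫⁻ x in Ioo (0 : ℝ) 1,
      ((ENNReal.ofReal (1 / (x + 2 ^ (k + 1)))) ^ 2 * f (x / (x + 2 ^ (k + 1))) +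
       (ENNReal.ofReal (1 / (1 + 2 ^ (k + 1) * x))) ^ 2 * f (1 / (1 + 2 ^ (k + 1) * x))) =
      ENNReal.ofReal (1 / 2 ^ (k + 1)) * ∫⁻ x in Ioo (0 : ℝ) 1, f x := by
    intro k
    have ha : (0 : ℝ) < 2 ^ (k + 1) := by positivity
    rw [lintegral_add_left (by fun_prop), lintegral_div_add_Ioo ha,
      lintegral_one_div_one_add_mul_Ioo ha, ← mul_add,
      lintegral_Ioo_add_Ioo (by positivity)
        ((div_lt_one (by positivity)).2 (lt_add_of_pos_right 1 ha))]
  simp_rw [hterm]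
  rw [ENNReal.tsum_mul_right, tsum_ofReal_one_div_two_pow_succ, one_mul]
end

section
/- For every real parameter s, every f : ℝ → [0, ∞], and every real x > 0, one has V_s[f](x) = V_s[Ũ_s[f]](x) + U_s[f](x). (Operator identity: V_s = V_s Ũ_s + U_s.) -/
open scoped ENNReal

/-- The Ruelle operator `U_s` : `U_s[f](x) = Σ_{k≥1} (1/(1+2^k x))^s · f(1/(1+2^k x))`. -/
noncomputable def opU (s : ℝ) (f : ℝ → ℝ≥0∞) (x : ℝ) : ℝ≥0∞ :=
  ∑' k : ℕ,
    ENNReal.ofReal ((1 / (1 + 2 ^ (k + 1) * x)) ^ s) * f (1 / (1 + 2 ^ (k + 1) * x))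

/-- The operator `Ũ_s` : `Ũ_s[f](x) = x^{-s} · U_s[f](1/x)`. -/
noncomputable def opUt (s : ℝ) (f : ℝ → ℝ≥0∞) (x : ℝ) : ℝ≥0∞ :=
  ENNReal.ofReal (x ^ (-s)) * opU s f (1 / x)

/-- Vallée's operator `V_s` :
`V_s[f](x) = Σ_{k≥1} Σ_{a odd, 0 < a < 2^k} (1/(a+2^k x))^s · f(1/(a+2^k x))`. -/
noncomputable def opV (s : ℝ) (f : ℝ → ℝ≥0∞) (x : ℝ) : ℝ≥0∞ :=
  ∑' k : ℕ, ∑' a : ℕ,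
    if Odd a ∧ 0 < a ∧ a < 2 ^ (k + 1) then
      ENNReal.ofReal ((1 / (a + 2 ^ (k + 1) * x)) ^ s) * f (1 / (a + 2 ^ (k + 1) * x))
    else 0

/-- The term of `opV` with denominator `b + 2 ^ (k + 1) * x`. -/
noncomputable def opVTerm (s : ℝ) (f : ℝ → ℝ≥0∞) (x : ℝ) (k b : ℕ) : ℝ≥0∞ :=
  ENNReal.ofReal ((1 / (b + 2 ^ (k + 1) * x)) ^ s) * f (1 / (b + 2 ^ (k + 1) * x))

theorem ofReal_rpow_mul_opUt (s : ℝ) (f : ℝ → ℝ≥0∞) {y : ℝ} (hy : 0 < y) :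
    ENNReal.ofReal (y ^ s) * opUt s f y = opU s f (1 / y) := by
  rw [opUt, ← mul_assoc, ← ENNReal.ofReal_mul (by positivity), ← Real.rpow_add hy]
  simp

theorem two_pow_mul_odd_inj {m n a b : ℕ} (ha : Odd a) (hb : Odd b)
    (h : 2 ^ m * a = 2 ^ n * b) : m = n ∧ a = b := by
  have key : ∀ {m n a b : ℕ}, Odd a → 2 ^ m * a = 2 ^ n * b → n ≤ m := by
    intro m n a b ha h
    have h2 : 2 ^ n ∣ 2 ^ m * a := ⟨b, h⟩
    have hc : Nat.Coprime (2 ^ n) a := (Nat.coprime_two_left.mpr ha).pow_left n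
    exact (Nat.pow_dvd_pow_iff_le_right (by norm_num)).mp (hc.dvd_of_dvd_mul_right h2)
  obtain rfl : m = n := le_antisymm (key hb h.symm) (key ha h)
  exact ⟨rfl, Nat.eq_of_mul_eq_mul_left (by positivity) h⟩

/-- Odd numbers in `(1, 2 ^ (K + 1))` are exactly the `1 + 2 ^ (m + 1) * a` with `a` odd in
`(0, 2 ^ (k + 1))` and `k + m + 1 = K`. -/
theorem tsum_odd_gt_one_eq (F : ℕ → ℕ → ℝ≥0∞) :
    (∑' p : ℕ × ℕ, if Odd p.2 ∧ 1 < p.2 ∧ p.2 < 2 ^ (p.1 + 1) then F p.1 p.2 else 0) =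
      ∑' q : ℕ × ℕ × ℕ, if Odd q.2.1 ∧ 0 < q.2.1 ∧ q.2.1 < 2 ^ (q.1 + 1) then
        F (q.1 + q.2.2 + 1) (1 + 2 ^ (q.2.2 + 1) * q.2.1) else 0 := by
  refine tsum_eq_tsum_of_ne_zero_bij
    (fun q ↦ (q.1.1 + q.1.2.2 + 1, 1 + 2 ^ (q.1.2.2 + 1) * q.1.2.1)) ?_ ?_ ?_
  · rintro ⟨⟨k, a, m⟩, h⟩ ⟨⟨k', a', m'⟩, h'⟩ he
    simp only [Function.mem_support, ne_eq, ite_eq_right_iff, Classical.not_imp] at h h'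
    simp only [Prod.mk.injEq, add_right_inj] at he
    obtain ⟨h1, h2⟩ := two_pow_mul_odd_inj h.1.1 h'.1.1 he.2
    simp only [Subtype.mk.injEq, Prod.mk.injEq]
    omega
  · rintro ⟨K, b⟩ h
    simp only [Function.mem_support, ne_eq, ite_eq_right_iff, Classical.not_imp] at h
    obtain ⟨⟨hodd, h1, hlt⟩, hF⟩ := h
    obtain ⟨m, a, ha, hb⟩ := Nat.exists_eq_two_pow_mul_odd (n := b - 1) (by omega)
    obtain _ | m := m
    · grind
    have ha0 := ha.pos
    have hb' : b = 1 + 2 ^ (m + 1) * a := by omega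
    have hmK : m + 1 < K + 1 := by
      refine (Nat.pow_lt_pow_iff_right (a := 2) (by norm_num)).mp ?_
      nlinarith [Nat.two_pow_pos (m + 1)]
    obtain ⟨k, rfl⟩ : ∃ k, K = k + m + 1 := ⟨K - m - 1, by omega⟩
    have hak : a < 2 ^ (k + 1) := by
      refine Nat.lt_of_mul_lt_mul_left (a := 2 ^ (m + 1)) ?_
      rw [← pow_add, show m + 1 + (k + 1) = k + m + 1 + 1 by omega]
      omega
    subst hb'
    refine ⟨⟨(k, a, m), ?_⟩, rfl⟩
    simpa [Function.mem_support, ha, ha0, hak] using hF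
  · rintro ⟨⟨k, a, m⟩, h⟩
    simp only [Function.mem_support, ne_eq, ite_eq_right_iff, Classical.not_imp] at h
    obtain ⟨⟨hodd, h0, hlt⟩, -⟩ := h
    have hpos := Nat.two_pow_pos (m + 1)
    have heven : Even (2 ^ (m + 1) * a) := by simp [Nat.even_pow]
    have hbound : 1 + 2 ^ (m + 1) * a < 2 ^ (k + m + 1 + 1) := by
      have h1 : 2 ^ (m + 1) * (a + 1) ≤ 2 ^ (m + 1) * 2 ^ (k + 1) := Nat.mul_le_mul_left _ hlt
      rw [← pow_add, show m + 1 + (k + 1) = k + m + 1 + 1 by omega, mul_add] at h1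
      have h2 : 2 ≤ 2 ^ (m + 1) := by rw [pow_succ]; have := Nat.two_pow_pos m; omega
      omega
    have hgt : 1 < 1 + 2 ^ (m + 1) * a := by have := Nat.mul_pos hpos h0; omega
    dsimp only
    rw [if_pos ⟨heven.one_add, hgt, hbound⟩, if_pos ⟨hodd, h0, hlt⟩]

theorem opV_eq_tsum_gt_one_add_opU (s : ℝ) (f : ℝ → ℝ≥0∞) (x : ℝ) :
    opV s f x = (∑' p : ℕ × ℕ, if Odd p.2 ∧ 1 < p.2 ∧ p.2 < 2 ^ (p.1 + 1) then
      opVTerm s f x p.1 p.2 else 0) + opU s f x := by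
  rw [ENNReal.tsum_prod', opU, ← ENNReal.tsum_add, opV]
  refine tsum_congr fun k ↦ ?_
  have hU : ENNReal.ofReal ((1 / (1 + 2 ^ (k + 1) * x)) ^ s) * f (1 / (1 + 2 ^ (k + 1) * x)) =
      ∑' b : ℕ, if b = 1 then opVTerm s f x k b else 0 := by
    rw [tsum_ite_eq]
    simp [opVTerm]
  rw [hU, ← ENNReal.tsum_add]
  refine tsum_congr fun b ↦ ?_
  have h1 : 1 < 2 ^ (k + 1) := Nat.one_lt_two_pow (by omega)
  rcases lt_trichotomy b 1 with hb | rfl | hb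
  · obtain rfl : b = 0 := by omega
    simp
  · simp [opVTerm]
  · simp [hb, hb.ne', opVTerm, (zero_lt_one.trans hb)]

theorem opV_opUt_eq_tsum (s : ℝ) (f : ℝ → ℝ≥0∞) {x : ℝ} (hx : 0 < x) :
    opV s (opUt s f) x =
      ∑' q : ℕ × ℕ × ℕ, if Odd q.2.1 ∧ 0 < q.2.1 ∧ q.2.1 < 2 ^ (q.1 + 1) then
        opVTerm s f x (q.1 + q.2.2 + 1) (1 + 2 ^ (q.2.2 + 1) * q.2.1) else 0 := by
  rw [ENNReal.tsum_prod', opV]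
  refine tsum_congr fun k ↦ ?_
  rw [ENNReal.tsum_prod']
  refine tsum_congr fun a ↦ ?_
  split_ifs with h
  · rw [ofReal_rpow_mul_opUt s f (by positivity), one_div_one_div, opU]
    refine tsum_congr fun m ↦ ?_
    have hden : (1 : ℝ) + 2 ^ (m + 1) * (a + 2 ^ (k + 1) * x) =
        (1 + 2 ^ (m + 1) * a : ℕ) + 2 ^ (k + m + 1 + 1) * x := by
      push_cast
      ring
    rw [opVTerm, hden]
  · simp

/-- The operator identity `V_s = V_s Ũ_s + U_s` pointwise on `(0,∞)`. -/
theorem opV_eq_opV_opUt_add_opU (s : ℝ) (f : ℝ → ℝ≥0∞) (x : ℝ) (hx : 0 < x) :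
    opV s f x = opV s (opUt s f) x + opU s f x := by
  rw [opV_eq_tsum_gt_one_add_opU, tsum_odd_gt_one_eq (opVTerm s f x), opV_opUt_eq_tsum s f hx]
end

section
/- Let f : ℝ → [0, ∞) be measurable, vanishing outside (0, 1], and integrable with F(x) = ∫₀ˣ f(t) dt and F(1) = 1. Let g(x) = Σ_{k≥1} (1/(1 + 2^k x))² f(1/(1 + 2^k x)) for x > 0 (that is, g = U₂[f]), and let G(x) = ∫₀ˣ g(t) dt. Then for every x > 0: G(x) = Σ_{k≥1} 2^{−k} ( 1 − F(1/(1 + 2^k x)) ). Equivalently, writing F̃ = 1 − F, G(x) = Σ_{k≥1} 2^{−k} F̃(1/(1 + 2^k x)). -/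
/-- `U₂[f](x) = Σ_{k≥1} (1/(1+2^k x))² · f(1/(1+2^k x))`. -/
noncomputable def opU2 (f : ℝ → ℝ) (x : ℝ) : ℝ :=
  ∑' k : ℕ, (1 / (1 + 2 ^ (k + 1) * x)) ^ 2 * f (1 / (1 + 2 ^ (k + 1) * x))

/-- The map `t ↦ 1 / (1 + a t)` sends `(0, x]` onto `[1 / (1 + a x), 1)`. -/
lemma image_one_div_one_add_mul_Ioc {a x : ℝ} (ha : 0 < a) (hx : 0 < x) :
    (fun t : ℝ => 1 / (1 + a * t)) '' Set.Ioc 0 x = Set.Ico (1 / (1 + a * x)) 1 := by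
  ext y
  simp only [Set.mem_image, Set.mem_Ioc, Set.mem_Ico]
  constructor
  · rintro ⟨t, ⟨ht0, htx⟩, rfl⟩
    have hat : 0 < a * t := mul_pos ha ht0
    refine ⟨one_div_le_one_div_of_le (by linarith) (by gcongr), ?_⟩
    rw [div_lt_one (by linarith)]
    linarith
  · rintro ⟨hy, hy1⟩
    have hax : 0 < 1 + a * x := by positivity
    have hy0 : 0 < y := lt_of_lt_of_le (by positivity) hy
    refine ⟨(1 / y - 1) / a, ⟨?_, ?_⟩, ?_⟩
    · have : 1 < 1 / y := by rwa [lt_div_iff₀ hy0, one_mul]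
      exact div_pos (by linarith) ha
    · rw [div_le_iff₀ ha, sub_le_iff_le_add, div_le_iff₀ hy0]
      rw [div_le_iff₀ hax] at hy
      linarith
    · field_simp
      ring

lemma hasDerivWithinAt_one_div_one_add_mul {a t : ℝ} (s : Set ℝ) (h : 1 + a * t ≠ 0) :
    HasDerivWithinAt (fun t : ℝ => 1 / (1 + a * t)) (-(a * (1 / (1 + a * t)) ^ 2)) s t := by
  have h1 : HasDerivAt (fun t : ℝ => 1 + a * t) a t := by
    simpa using ((hasDerivAt_id t).const_mul a).const_add 1
  have heq : -(a * (1 / (1 + a * t)) ^ 2) = -a / (1 + a * t) ^ 2 := by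
    rw [one_div, inv_pow, neg_div, div_eq_mul_inv]
  rw [heq]
  simp only [one_div]
  exact (h1.fun_inv h).hasDerivWithinAt

lemma injOn_one_div_one_add_mul {a : ℝ} (ha : 0 < a) (x : ℝ) :
    Set.InjOn (fun t : ℝ => 1 / (1 + a * t)) (Set.Ioc 0 x) := by
  intro s _ t _ hst
  simp only [one_div, inv_inj, add_right_inj] at hst
  exact mul_left_cancel₀ ha.ne' hst

lemma abs_neg_mul_sq_smul {a : ℝ} (ha : 0 < a) (u v : ℝ) :
    |-(a * u ^ 2)| • v = a * (u ^ 2 * v) := by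
  rw [abs_neg, abs_of_nonneg (by positivity), smul_eq_mul, mul_assoc]

open MeasureTheory in
lemma integrableOn_sq_mul_comp_one_div {f : ℝ → ℝ} (hint : IntegrableOn f (Set.Ioc 0 1))
    {a x : ℝ} (ha : 0 < a) (hx : 0 < x) :
    IntegrableOn (fun t => (1 / (1 + a * t)) ^ 2 * f (1 / (1 + a * t))) (Set.Ioc 0 x) := by
  have hsub : Set.Ico (1 / (1 + a * x)) 1 ⊆ Set.Ioc 0 1 := fun y hy =>
    ⟨lt_of_lt_of_le (by positivity) hy.1, hy.2.le⟩
  have h := hint.mono_set hsub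
  rw [← image_one_div_one_add_mul_Ioc ha hx,
    integrableOn_image_iff_integrableOn_abs_deriv_smul measurableSet_Ioc
      (fun t ht => hasDerivWithinAt_one_div_one_add_mul _
        (by have := mul_pos ha ht.1; positivity))
      (injOn_one_div_one_add_mul ha x)] at h
  simp only [abs_neg_mul_sq_smul ha] at h
  exact (integrable_const_mul_iff (isUnit_iff_ne_zero.2 ha.ne') _).1 h

open MeasureTheory in
lemma setIntegral_sq_mul_comp_one_div (f : ℝ → ℝ) {a x : ℝ} (ha : 0 < a) (hx : 0 < x) :
    ∫ t in Set.Ioc 0 x, (1 / (1 + a * t)) ^ 2 * f (1 / (1 + a * t)) =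
      a⁻¹ * ∫ u in (1 / (1 + a * x))..1, f u := by
  have hle : 1 / (1 + a * x) ≤ 1 := by
    have := mul_pos ha hx
    rw [div_le_one (by positivity)]
    linarith
  rw [intervalIntegral.integral_of_le hle, ← integral_Ico_eq_integral_Ioc (x := 1 / (1 + a * x)),
    ← image_one_div_one_add_mul_Ioc ha hx,
    integral_image_eq_integral_abs_deriv_smul measurableSet_Ioc
      (fun t ht => hasDerivWithinAt_one_div_one_add_mul _
        (by have := mul_pos ha ht.1; positivity))
      (injOn_one_div_one_add_mul ha x)]
  simp only [abs_neg_mul_sq_smul ha]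
  rw [integral_const_mul, inv_mul_cancel_left₀ ha.ne']

/-- If `f` is a nonnegative measurable density vanishing outside `(0,1]` with
distribution `F`, `F(1) = 1`, and `g = U₂[f]` with `G(x) = ∫₀ˣ g`, then
`G(x) = Σ_{k≥1} 2^{−k} (1 − F(1/(1+2^k x))) = Σ_{k≥1} 2^{−k} F̃(1/(1+2^k x))`. -/
theorem G_eq_sum_Ftilde (f : ℝ → ℝ) (hmeas : Measurable f) (hnonneg : ∀ x, 0 ≤ f x)
    (hsupp : ∀ x, x ∉ Set.Ioc (0 : ℝ) 1 → f x = 0)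
    (hint : MeasureTheory.IntegrableOn f (Set.Ioc (0 : ℝ) 1))
    (F : ℝ → ℝ) (hF : ∀ x, F x = ∫ t in (0 : ℝ)..x, f t) (hF1 : F 1 = 1)
    (G : ℝ → ℝ) (hG : ∀ x, G x = ∫ t in (0 : ℝ)..x, opU2 f t) :
    ∀ x : ℝ, 0 < x →
      G x = ∑' k : ℕ, (1 / 2 : ℝ) ^ (k + 1) * (1 - F (1 / (1 + 2 ^ (k + 1) * x))) := by
  intro x hx
  have hpow : ∀ k : ℕ, (0 : ℝ) < 2 ^ (k + 1) := fun k => by positivity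
  have hterm : ∀ k : ℕ,
      ∫ t in Set.Ioc 0 x, (1 / (1 + 2 ^ (k + 1) * t)) ^ 2 * f (1 / (1 + 2 ^ (k + 1) * t)) =
        (1 / 2 : ℝ) ^ (k + 1) * (1 - F (1 / (1 + 2 ^ (k + 1) * x))) := by
    intro k
    have hle : 1 / (1 + 2 ^ (k + 1) * x) ≤ 1 := by
      have := mul_pos (hpow k) hx
      rw [div_le_one (by positivity)]
      linarith
    have h01 : IntervalIntegrable f MeasureTheory.volume 0 1 :=
      (intervalIntegrable_iff_integrableOn_Ioc_of_le zero_le_one).2 hint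
    have h0y : IntervalIntegrable f MeasureTheory.volume 0 (1 / (1 + 2 ^ (k + 1) * x)) :=
      (intervalIntegrable_iff_integrableOn_Ioc_of_le (by positivity)).2
        (hint.mono_set (Set.Ioc_subset_Ioc_right hle))
    rw [setIntegral_sq_mul_comp_one_div f (hpow k) hx,
      ← intervalIntegral.integral_interval_sub_left h01 h0y, ← hF, ← hF, hF1, one_div_pow, one_div (2 ^ (k + 1))]
  have hFnonneg : ∀ k : ℕ, 0 ≤ F (1 / (1 + 2 ^ (k + 1) * x)) := fun k => by
    rw [hF]
    exact intervalIntegral.integral_nonneg (by positivity) fun u _ => hnonneg u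
  have hsum : Summable fun k : ℕ => ∫ t in Set.Ioc 0 x,
      ‖(1 / (1 + 2 ^ (k + 1) * t)) ^ 2 * f (1 / (1 + 2 ^ (k + 1) * t))‖ := by
    refine Summable.of_nonneg_of_le
      (fun k => MeasureTheory.integral_nonneg fun t => norm_nonneg _) (fun k => ?_)
      ((summable_nat_add_iff 1).2 summable_geometric_two)
    have hnorm : ∀ t : ℝ,
        ‖(1 / (1 + 2 ^ (k + 1) * t)) ^ 2 * f (1 / (1 + 2 ^ (k + 1) * t))‖ =
          (1 / (1 + 2 ^ (k + 1) * t)) ^ 2 * f (1 / (1 + 2 ^ (k + 1) * t)) := fun t =>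
      Real.norm_of_nonneg (mul_nonneg (sq_nonneg _) (hnonneg _))
    simp only [hnorm]
    rw [hterm]
    exact mul_le_of_le_one_right (by positivity) (by linarith [hFnonneg k])
  have h := MeasureTheory.hasSum_integral_of_summable_integral_norm
    (fun k => integrableOn_sq_mul_comp_one_div hint (hpow k) hx) hsum
  rw [hG, intervalIntegral.integral_of_le hx.le]
  simp only [opU2, ← h.tsum_eq, hterm]
end

section
/- Let f : ℝ → [0, ∞) be measurable, vanishing outside (0, 1], and integrable with F(x) = ∫₀ˣ f(t) dt and F(1) = 1. Let g = U₂[f] and G(x) = ∫₀ˣ g(t) dt. Then G(x) tends to 1 as x → +∞; that is, G(+∞) = ∫₀^∞ g(t) dt = 1. -/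
open Filter

open MeasureTheory in
/-- The change of variables `t = 1 / (1 + c x)` maps `(0, ∞)` onto `(0, 1)`. -/
lemma integral_one_div_one_add_mul (f : ℝ → ℝ) {c : ℝ} (hc : 0 < c)
    (hint : IntegrableOn f (Set.Ioc (0 : ℝ) 1)) :
    IntegrableOn (fun x => (1 / (1 + c * x)) ^ 2 * f (1 / (1 + c * x))) (Set.Ioi 0) ∧
      ∫ x in Set.Ioi (0 : ℝ), (1 / (1 + c * x)) ^ 2 * f (1 / (1 + c * x)) =
        c⁻¹ * ∫ t in Set.Ioc (0 : ℝ) 1, f t := by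
  have hpos : ∀ x ∈ Set.Ioi (0 : ℝ), 0 < 1 + c * x := fun x hx => by
    have : 0 < c * x := mul_pos hc hx
    linarith
  have hderiv : ∀ x ∈ Set.Ioi (0 : ℝ), HasDerivWithinAt (fun x => 1 / (1 + c * x))
      (-c / (1 + c * x) ^ 2) (Set.Ioi 0) x := fun x hx => by
    have h : HasDerivAt (fun x : ℝ => 1 + c * x) c x := by
      simpa using ((hasDerivAt_id x).const_mul c).const_add 1
    simpa only [one_div] using (h.fun_inv (hpos x hx).ne').hasDerivWithinAt
  have hinj : Set.InjOn (fun x => 1 / (1 + c * x)) (Set.Ioi (0 : ℝ)) := fun x _ y _ h => by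
    have h' : (1 + c * x)⁻¹ = (1 + c * y)⁻¹ := by simpa only [one_div] using h
    exact mul_left_cancel₀ hc.ne' (add_left_cancel (inv_injective h'))
  have himage : (fun x => 1 / (1 + c * x)) '' Set.Ioi (0 : ℝ) = Set.Ioo 0 1 := by
    ext t
    constructor
    · rintro ⟨x, hx, rfl⟩
      have hcx : 0 < c * x := mul_pos hc hx
      exact ⟨one_div_pos.2 (hpos x hx), (div_lt_one (hpos x hx)).2 (by linarith)⟩
    · rintro ⟨h0, h1⟩
      refine ⟨(t⁻¹ - 1) / c, div_pos (sub_pos.2 ((one_lt_inv₀ h0).2 h1)) hc, ?_⟩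
      simp only [mul_div_cancel₀ _ hc.ne', add_sub_cancel, one_div, inv_inv]
  have hfun : ∀ x, |-c / (1 + c * x) ^ 2| • f (1 / (1 + c * x)) =
      c * ((1 / (1 + c * x)) ^ 2 * f (1 / (1 + c * x))) := fun x => by
    rw [abs_div, abs_neg, abs_of_pos hc, abs_of_nonneg (sq_nonneg _), smul_eq_mul,
      one_div_pow]
    ring
  constructor
  · have h := (integrableOn_image_iff_integrableOn_abs_deriv_smul measurableSet_Ioi hderiv hinj
      f).1 (himage ▸ hint.mono_set Set.Ioo_subset_Ioc_self)
    simp only [hfun] at h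
    exact (integrable_const_mul_iff hc.ne'.isUnit _).1 h
  · have h := integral_image_eq_integral_abs_deriv_smul measurableSet_Ioi hderiv hinj f
    simp only [hfun] at h
    rw [himage, integral_const_mul, ← integral_Ioc_eq_integral_Ioo] at h
    rw [h, inv_mul_cancel_left₀ hc.ne']

/-- If `f` is a nonnegative measurable density vanishing outside `(0,1]` with
`F(1) = ∫₀¹ f = 1`, and `g = U₂[f]` with `G(x) = ∫₀ˣ g`, then `G(x) → 1` as
`x → +∞`; that is, `G(+∞) = ∫₀^∞ g = 1`. -/
theorem G_tendsto_one (f : ℝ → ℝ) (hmeas : Measurable f) (hnonneg : ∀ x, 0 ≤ f x)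
    (hsupp : ∀ x, x ∉ Set.Ioc (0 : ℝ) 1 → f x = 0)
    (hint : MeasureTheory.IntegrableOn f (Set.Ioc (0 : ℝ) 1))
    (F : ℝ → ℝ) (hF : ∀ x, F x = ∫ t in (0 : ℝ)..x, f t) (hF1 : F 1 = 1)
    (G : ℝ → ℝ) (hG : ∀ x, G x = ∫ t in (0 : ℝ)..x, opU2 f t) :
    Tendsto G atTop (nhds 1) ∧ ∫ t in Set.Ioi (0 : ℝ), opU2 f t = 1 := by
  have h1 : ∫ t in Set.Ioc (0 : ℝ) 1, f t = 1 := by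
    rw [← intervalIntegral.integral_of_le zero_le_one, ← hF, hF1]
  have hterm := fun k : ℕ =>
    integral_one_div_one_add_mul f (c := 2 ^ (k + 1)) (by positivity) hint
  simp only [h1, mul_one] at hterm
  have hsum : HasSum (fun k : ℕ => ((2 : ℝ) ^ (k + 1))⁻¹) 1 := by
    simpa [pow_succ, div_eq_mul_inv, mul_comm] using hasSum_geometric_two' (1 : ℝ)
  have hint1 : ∫ t in Set.Ioi (0 : ℝ), opU2 f t = 1 := by
    have h := MeasureTheory.hasSum_integral_of_summable_integral_norm
      (fun k => (hterm k).1) (by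
        convert hsum.summable using 2 with k
        rw [← (hterm k).2]
        congr 1 with x
        exact Real.norm_of_nonneg (mul_nonneg (sq_nonneg _) (hnonneg _)))
    simp only [fun k => (hterm k).2] at h
    exact h.unique hsum
  refine ⟨?_, hint1⟩
  have hg : MeasureTheory.IntegrableOn (opU2 f) (Set.Ioi 0) :=
    MeasureTheory.Integrable.of_integral_ne_zero (by rw [hint1]; exact one_ne_zero)
  rw [funext hG, ← hint1]
  exact MeasureTheory.intervalIntegral_tendsto_integral_Ioi 0 hg tendsto_id
end

section
/- Let F̃ : (0, ∞) → ℝ be a bounded function satisfying the functional equation F̃(x) = Σ_{k≥1} 2^{−k} ( F̃(1/(1 + 2^k/x)) − F̃(1/(1 + 2^k x)) ) for all x > 0, and define G(x) = Σ_{k≥1} 2^{−k} F̃(1/(1 + 2^k x)) for x > 0. Then for all x > 0: F̃(x) = G(1/x) − G(x), and consequently F̃(1/x) = −F̃(x) (so F̃(e^{−y}) is an odd function of y, and F̃(1) = 0). -/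
/-- A bounded sequence is summable against the weights `2^{-(k+1)}`. -/
theorem summable_half_pow_succ_mul_of_abs_le {a : ℕ → ℝ} {C : ℝ} (ha : ∀ k, |a k| ≤ C) :
    Summable fun k : ℕ => (1 / 2 : ℝ) ^ (k + 1) * a k := by
  have hgeom : Summable fun k : ℕ => (1 / 2 : ℝ) ^ (k + 1) * C :=
    ((summable_nat_add_iff 1).mpr summable_geometric_two).mul_right C
  refine hgeom.of_norm_bounded fun k => ?_
  rw [Real.norm_eq_abs, abs_mul, abs_of_pos (by positivity)]
  gcongr
  exact ha k


/-- If `F̃` is bounded on `(0,∞)` and satisfies the functional equation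
`F̃(x) = Σ_{k≥1} 2^{−k} (F̃(1/(1+2^k/x)) − F̃(1/(1+2^k x)))`, and
`G(x) = Σ_{k≥1} 2^{−k} F̃(1/(1+2^k x))`, then `F̃(x) = G(1/x) − G(x)` and
`F̃(1/x) = −F̃(x)` for all `x > 0` (so `F̃(e^{−y})` is odd in `y` and `F̃(1) = 0`). -/
theorem Ftilde_eq_G_sub_G (Ft : ℝ → ℝ) (C : ℝ) (hbdd : ∀ x : ℝ, 0 < x → |Ft x| ≤ C)
    (hfe : ∀ x : ℝ, 0 < x →
      Ft x = ∑' k : ℕ, (1 / 2 : ℝ) ^ (k + 1) *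
        (Ft (1 / (1 + 2 ^ (k + 1) / x)) - Ft (1 / (1 + 2 ^ (k + 1) * x))))
    (G : ℝ → ℝ)
    (hG : ∀ x : ℝ, 0 < x →
      G x = ∑' k : ℕ, (1 / 2 : ℝ) ^ (k + 1) * Ft (1 / (1 + 2 ^ (k + 1) * x))) :
    ∀ x : ℝ, 0 < x → Ft x = G (1 / x) - G x ∧ Ft (1 / x) = -Ft x := by
  have hsum : ∀ x : ℝ, 0 < x →
      Summable fun k : ℕ => (1 / 2 : ℝ) ^ (k + 1) * Ft (1 / (1 + 2 ^ (k + 1) * x)) :=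
    fun x hx => summable_half_pow_succ_mul_of_abs_le fun k => hbdd _ (by positivity)
  have key : ∀ x : ℝ, 0 < x → Ft x = G (1 / x) - G x := by
    intro x hx
    have hx' : 0 < 1 / x := by positivity
    rw [hfe x hx, hG _ hx', hG x hx, ← (hsum _ hx').tsum_sub (hsum x hx)]
    simp only [mul_one_div, mul_sub]
  intro x hx
  refine ⟨key x hx, ?_⟩
  rw [key (1 / x) (by positivity), key x hx, one_div_one_div, neg_sub]
end

section
/- For every real x with 0 < x < 1: Σ_{k≥1} 2^{−k}/(1 + 2^k x) = 1 + x log₂ x + x/2 + x·P(log₂ x) + Σ_{n≥2} (−1)ⁿ xⁿ/(2^{1−n} − 1), where P(t) = (2π/ln 2) Σ_{n≥1} sin(2πnt)/sinh(2π²n/ln 2). In particular the expansion begins 1 + x log₂ x + x/2 + x P(log₂ x) − 2x² + (4/3)x³ − ⋯, and the term x·P(log₂ x) (omitted in error in Lemma 3.1 of Brent 1976) is present. -/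
open Real

/-- The tiny periodic function
`P(t) = (2π/ln 2) Σ_{n≥1} sin(2πnt)/sinh(2π²n/ln 2)` arising from the complex
poles in the Mellin inversion. -/
noncomputable def mellinP (t : ℝ) : ℝ :=
  (2 * π / Real.log 2) *
    ∑' n : ℕ, Real.sin (2 * π * (n + 1) * t) / Real.sinh (2 * π ^ 2 * (n + 1) / Real.log 2)

open MeasureTheory Filter Topology Asymptotics FourierTransform

lemma integrable_sigmoid_mul_one_sub :
    Integrable (fun v : ℝ => Real.sigmoid v * (1 - Real.sigmoid v)) := by
  have h := (MeasureTheory.integrableOn_image_iff_integrableOn_abs_deriv_smul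
    (s := Set.univ) (f := Real.sigmoid) (f' := fun v => Real.sigmoid v * (1 - Real.sigmoid v))
    MeasurableSet.univ (fun v _ => (Real.hasDerivAt_sigmoid v).hasDerivWithinAt)
    (Real.sigmoid_injective.injOn) (fun _ => (1 : ℝ))).1 (by
      rw [Set.image_univ, Real.range_sigmoid]
      simp)
  rw [integrableOn_univ] at h
  refine h.congr (Eventually.of_forall fun v => ?_)
  have h1 := Real.sigmoid_pos v
  have h2 := Real.sigmoid_lt_one v
  simp only [smul_eq_mul, mul_one]
  rw [abs_of_pos (mul_pos h1 (by linarith))]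

lemma one_sub_sigmoid_eq (v : ℝ) : 1 - Real.sigmoid v = Real.sigmoid v * Real.exp (-v) := by
  rw [Real.sigmoid_mul_rexp_neg, Real.sigmoid_neg]

lemma integral_cexp_mul_sigmoid_mul_one_sub {a : ℝ} (ha : a ≠ 0) :
    ∫ v : ℝ, Complex.exp (-(a * v) * Complex.I) *
      ((Real.sigmoid v * (1 - Real.sigmoid v) : ℝ) : ℂ) = ((π * a / Real.sinh (π * a) : ℝ) : ℂ) := by
  have h := MeasureTheory.integral_image_eq_integral_abs_deriv_smul
    (s := Set.univ) (f := Real.sigmoid) (f' := fun v => Real.sigmoid v * (1 - Real.sigmoid v))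
    MeasurableSet.univ (fun v _ => (Real.hasDerivAt_sigmoid v).hasDerivWithinAt)
    (Real.sigmoid_injective.injOn) (fun x : ℝ => (x : ℂ) ^ ((1 - a * Complex.I) - 1) *
      (1 - (x : ℂ)) ^ ((1 + a * Complex.I) - 1))
  rw [Set.image_univ, Real.range_sigmoid, setIntegral_univ] at h
  have hB : Complex.betaIntegral (1 - a * Complex.I) (1 + a * Complex.I) =
      ((π * a / Real.sinh (π * a) : ℝ) : ℂ) := by
    have h1 := Complex.Gamma_mul_Gamma_eq_betaIntegral (s := 1 - a * Complex.I)
      (t := 1 + a * Complex.I) (by simp) (by simp)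
    have haI : (a * Complex.I : ℂ) ≠ 0 := by simp [ha]
    have h2 : Complex.Gamma (1 - a * Complex.I + (1 + a * Complex.I)) = 1 := by
      rw [show (1 - a * Complex.I + (1 + a * Complex.I) : ℂ) = 1 + 1 by ring,
        Complex.Gamma_add_one _ one_ne_zero, Complex.Gamma_one, one_mul]
    rw [h2, one_mul, add_comm 1 (a * Complex.I : ℂ), Complex.Gamma_add_one _ haI] at h1
    rw [add_comm 1 (a * Complex.I : ℂ), ← h1, mul_left_comm, mul_comm (Complex.Gamma _),
      Complex.Gamma_mul_Gamma_one_sub, ← mul_assoc, Complex.sin_mul_I]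
    push_cast
    field_simp
  rw [Complex.betaIntegral, intervalIntegral.integral_of_le zero_le_one,
    integral_Ioc_eq_integral_Ioo, h] at hB
  rw [← hB]
  congr 1
  ext v
  have h1 := Real.sigmoid_pos v
  have h2 := Real.sigmoid_lt_one v
  have hpos : (0 : ℝ) < 1 - Real.sigmoid v := by linarith
  rw [abs_of_pos (mul_pos h1 hpos), Complex.real_smul, mul_comm]
  congr 1
  have hl : Real.log (1 - Real.sigmoid v) = Real.log (Real.sigmoid v) - v := by
    rw [one_sub_sigmoid_eq, Real.log_mul h1.ne' (Real.exp_pos _).ne', Real.log_exp]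
    ring
  rw [show (1 : ℂ) - (Real.sigmoid v : ℂ) = ((1 - Real.sigmoid v : ℝ) : ℂ) by push_cast; ring,
    Complex.cpow_def_of_ne_zero (by exact_mod_cast h1.ne'),
    Complex.cpow_def_of_ne_zero (by exact_mod_cast hpos.ne'),
    ← Complex.ofReal_log h1.le, ← Complex.ofReal_log hpos.le, hl, ← Complex.exp_add]
  congr 1
  push_cast
  ring

lemma integral_comp_mul_add {E : Type*} [NormedAddCommGroup E] [NormedSpace ℝ E] (g : ℝ → E)
    {c : ℝ} (hc : 0 < c) (s : ℝ) : ∫ u : ℝ, g (c * u + s) = c⁻¹ • ∫ v : ℝ, g v := by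
  rw [Measure.integral_comp_mul_left (fun v => g (v + s)) c, integral_add_right_eq_self,
    abs_of_pos (inv_pos.2 hc)]

lemma fourier_sigmoid_deriv {c : ℝ} (hc : 0 < c) (s : ℝ) {ξ : ℝ} (hξ : ξ ≠ 0) :
    𝓕 (fun u : ℝ => ((c * (Real.sigmoid (c * u + s) * (1 - Real.sigmoid (c * u + s))) : ℝ) : ℂ)) ξ =
      Complex.exp (2 * π * ξ / c * s * Complex.I) *
        ((π * (2 * π * ξ / c) / Real.sinh (π * (2 * π * ξ / c)) : ℝ) : ℂ) := by
  have ha : 2 * π * ξ / c ≠ 0 := by positivity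
  rw [← integral_cexp_mul_sigmoid_mul_one_sub ha, Real.fourier_eq', ← integral_const_mul]
  have h := integral_comp_mul_add (fun v : ℝ => Complex.exp (2 * π * ξ / c * s * Complex.I) *
    (Complex.exp (-((2 * π * ξ / c : ℝ) * v) * Complex.I) *
      ((Real.sigmoid v * (1 - Real.sigmoid v) : ℝ) : ℂ))) hc s
  rw [eq_inv_smul_iff₀ hc.ne', Complex.real_smul, ← integral_const_mul] at h
  have hc' : (c : ℂ) ≠ 0 := by exact_mod_cast hc.ne'
  rw [← h]
  congr 1
  ext u
  rw [← mul_assoc (Complex.exp _), ← Complex.exp_add]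
  simp only [smul_eq_mul, RCLike.inner_apply, conj_trivial]
  push_cast
  rw [mul_left_comm]
  congr 3
  field_simp
  ring

lemma sigmoid_le_exp (v : ℝ) : Real.sigmoid v ≤ Real.exp v := by
  have h := Real.sigmoid_mul_rexp_neg (-v)
  rw [neg_neg] at h
  rw [← h]
  exact mul_le_of_le_one_left (Real.exp_pos _).le (Real.sigmoid_le_one _)

lemma sigmoid_sub_sigmoid_add_le (v : ℝ) {s : ℝ} (hs : s ≤ 0) :
    Real.sigmoid v - Real.sigmoid (v + s) ≤
      Real.exp (-s) * (Real.sigmoid v * (1 - Real.sigmoid v)) := by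
  have h1 := Real.sigmoid_pos v
  have h2 := Real.sigmoid_pos (v + s)
  have hv : Real.exp (-v) = (1 - Real.sigmoid v) / Real.sigmoid v := by
    rw [one_sub_sigmoid_eq]; field_simp
  have hd : Real.sigmoid v - Real.sigmoid (v + s) =
      Real.sigmoid v * Real.sigmoid (v + s) * (Real.exp (-(v + s)) - Real.exp (-v)) := by
    have e1 := one_sub_sigmoid_eq v
    have e2 := one_sub_sigmoid_eq (v + s)
    linear_combination (-Real.sigmoid (v + s)) * e1 + Real.sigmoid v * e2
  have h3 := Real.sigmoid_le (show v + s ≤ v by linarith)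
  have h4 : Real.exp (-(v + s)) = Real.exp (-s) * Real.exp (-v) := by
    rw [← Real.exp_add]; ring_nf
  have h5 := Real.exp_pos (-v)
  have h6 := Real.exp_pos (-s)
  rw [hd, h4, one_sub_sigmoid_eq]
  calc Real.sigmoid v * Real.sigmoid (v + s) * (Real.exp (-s) * Real.exp (-v) - Real.exp (-v))
      ≤ Real.sigmoid v * Real.sigmoid (v + s) * (Real.exp (-s) * Real.exp (-v)) := by
        gcongr; linarith
    _ ≤ Real.sigmoid v * Real.sigmoid v * (Real.exp (-s) * Real.exp (-v)) := by gcongr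
    _ = _ := by ring

lemma sigmoid_mul_one_sub_le_exp_neg_abs (v : ℝ) :
    Real.sigmoid v * (1 - Real.sigmoid v) ≤ Real.exp (-|v|) := by
  have h0 := Real.sigmoid_pos v
  have h1 := Real.sigmoid_lt_one v
  rcases le_total 0 v with h | h
  · rw [abs_of_nonneg h, ← Real.sigmoid_neg]
    exact (mul_le_of_le_one_left (Real.sigmoid_pos _).le h1.le).trans (sigmoid_le_exp _)
  · rw [abs_of_nonpos h, neg_neg]
    exact (mul_le_of_le_one_right h0.le (by linarith)).trans (sigmoid_le_exp _)

/-- The difference of two translates of the sigmoid at scale `c`. -/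
noncomputable def sigmoidDiff (c s u : ℝ) : ℝ := Real.sigmoid (c * u) - Real.sigmoid (c * u + s)

lemma abs_sigmoidDiff_le (c : ℝ) {s : ℝ} (hs : s ≤ 0) (u : ℝ) :
    |sigmoidDiff c s u| ≤ Real.exp (-s) * (Real.sigmoid (c * u) * (1 - Real.sigmoid (c * u))) := by
  rw [sigmoidDiff, abs_of_nonneg (sub_nonneg.2 (Real.sigmoid_le (by linarith)))]
  exact sigmoid_sub_sigmoid_add_le _ hs

lemma continuous_sigmoidDiff (c s : ℝ) : Continuous (sigmoidDiff c s) := by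
  have := continuous_sigmoid
  unfold sigmoidDiff
  fun_prop

lemma integrable_sigmoidDiff {c : ℝ} (hc : 0 < c) {s : ℝ} (hs : s ≤ 0) :
    Integrable (sigmoidDiff c s) := by
  refine ((integrable_sigmoid_mul_one_sub.comp_mul_left' hc.ne').const_mul (Real.exp (-s))).mono'
    (continuous_sigmoidDiff c s).aestronglyMeasurable (Eventually.of_forall fun u => ?_)
  exact abs_sigmoidDiff_le c hs u

lemma sigmoidDiff_isBigO {c : ℝ} (hc : 0 < c) {s : ℝ} (hs : s ≤ 0) :
    (fun u => (sigmoidDiff c s u : ℂ)) =O[cocompact ℝ] fun u : ℝ => |u| ^ (-2 : ℝ) := by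
  have h1 : (fun u => (sigmoidDiff c s u : ℂ)) =O[cocompact ℝ] fun u : ℝ => Real.exp (-c * |u|) := by
    refine IsBigO.of_bound (Real.exp (-s)) (Eventually.of_forall fun u => ?_)
    rw [Complex.norm_real, Real.norm_eq_abs, Real.norm_eq_abs, abs_of_pos (Real.exp_pos _)]
    refine (abs_sigmoidDiff_le c hs u).trans ?_
    gcongr
    refine (sigmoid_mul_one_sub_le_exp_neg_abs _).trans_eq ?_
    rw [abs_mul, abs_of_pos hc, neg_mul]
  exact h1.trans ((isLittleO_exp_neg_mul_rpow_atTop hc (-2)).isBigO.comp_tendsto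
    (tendsto_norm_cocompact_atTop (E := ℝ)))

lemma hasDerivAt_sigmoid_comp_mul_add (c s u : ℝ) :
    HasDerivAt (fun u => Real.sigmoid (c * u + s))
      (c * (Real.sigmoid (c * u + s) * (1 - Real.sigmoid (c * u + s)))) u := by
  have h : HasDerivAt (fun u : ℝ => c * u + s) c u := by
    simpa using ((hasDerivAt_id u).const_mul c).add_const s
  rw [mul_comm c]
  exact (Real.hasDerivAt_sigmoid _).comp u h

lemma hasDerivAt_sigmoidDiff (c s u : ℝ) :
    HasDerivAt (sigmoidDiff c s) (c * (Real.sigmoid (c * u) * (1 - Real.sigmoid (c * u))) -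
      c * (Real.sigmoid (c * u + s) * (1 - Real.sigmoid (c * u + s)))) u := by
  have h0 := hasDerivAt_sigmoid_comp_mul_add c 0 u
  simp only [add_zero] at h0
  exact h0.sub (hasDerivAt_sigmoid_comp_mul_add c s u)

lemma integrable_sigmoid_deriv {c : ℝ} (hc : 0 < c) (s : ℝ) :
    Integrable (fun u : ℝ =>
      ((c * (Real.sigmoid (c * u + s) * (1 - Real.sigmoid (c * u + s))) : ℝ) : ℂ)) := by
  have h := ((integrable_sigmoid_mul_one_sub.comp_add_right s).comp_mul_left' hc.ne').const_mul c
  exact h.ofReal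

lemma fourier_sigmoidDiff {c : ℝ} (hc : 0 < c) {s : ℝ} (hs : s ≤ 0) {ξ : ℝ} (hξ : ξ ≠ 0) :
    𝓕 (fun u : ℝ => (sigmoidDiff c s u : ℂ)) ξ =
      Complex.I * (Complex.exp (2 * π * ξ / c * s * Complex.I) - 1) *
        ((π / c / Real.sinh (2 * π ^ 2 * ξ / c) : ℝ) : ℂ) := by
  have hd (u : ℝ) := (hasDerivAt_sigmoidDiff c s u).ofReal_comp
  have hI0 := integrable_sigmoid_deriv hc 0
  have hIs := integrable_sigmoid_deriv hc s
  have hderiv : deriv (fun u : ℝ => (sigmoidDiff c s u : ℂ)) =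
      (fun u : ℝ => ((c * (Real.sigmoid (c * u + 0) * (1 - Real.sigmoid (c * u + 0))) : ℝ) : ℂ)) -
      (fun u : ℝ => ((c * (Real.sigmoid (c * u + s) * (1 - Real.sigmoid (c * u + s))) : ℝ) : ℂ)) := by
    ext u
    rw [(hd u).deriv]
    simp
  have h := congrFun (Real.fourier_deriv (integrable_sigmoidDiff hc hs).ofReal
    (fun u => (hd u).differentiableAt) (by rw [hderiv]; exact hI0.sub hIs)) ξ
  have hsub : 𝓕 (deriv (fun u : ℝ => (sigmoidDiff c s u : ℂ))) ξ =
      (1 - Complex.exp (2 * π * ξ / c * s * Complex.I)) *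
        ((π * (2 * π * ξ / c) / Real.sinh (π * (2 * π * ξ / c)) : ℝ) : ℂ) := by
    have e0 := fourier_sigmoid_deriv hc 0 hξ
    have es := fourier_sigmoid_deriv hc s hξ
    rw [Complex.ofReal_zero, mul_zero, zero_mul, Complex.exp_zero] at e0
    rw [sub_mul, ← e0, ← es, hderiv]
    simp only [Real.fourier_eq]
    rw [← integral_sub]
    · simp only [Pi.sub_apply, smul_sub]
    · exact (Real.fourierIntegral_convergent_iff ξ).2 hI0
    · exact (Real.fourierIntegral_convergent_iff ξ).2 hIs
  rw [hsub, smul_eq_mul] at h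
  have hne : (2 * π * Complex.I * ξ : ℂ) ≠ 0 := by simp [hξ, Real.pi_ne_zero]
  rw [← mul_right_inj' hne]
  refine Eq.trans h.symm ?_
  rw [show π * (2 * π * ξ / c) = 2 * π ^ 2 * ξ / c by ring]
  push_cast
  generalize Complex.exp _ = E
  generalize Complex.sinh _ = S
  linear_combination (-2 * π ^ 2 * ξ / (c * S) * (E - 1)) * Complex.I_sq

lemma integral_sigmoidDiff {c : ℝ} (hc : 0 < c) {s : ℝ} (hs : s ≤ 0) :
    ∫ u, sigmoidDiff c s u = -s / c := by
  have hlog (s u : ℝ) : HasDerivAt (fun u => -Real.log (Real.sigmoid (-(c * u + s))) / c)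
      (Real.sigmoid (c * u + s)) u := by
    have h := (((hasDerivAt_sigmoid_comp_mul_add (-c) (-s) u).log
      (Real.sigmoid_pos _).ne').neg).div_const c
    have hp := Real.sigmoid_pos (-c * u + -s)
    have e (u : ℝ) : -(c * u + s) = -c * u + -s := by ring
    simp only [e]
    refine h.congr_deriv ?_
    rw [← neg_neg (c * u + s), Real.sigmoid_neg, e]
    generalize Real.sigmoid (-c * u + -s) = A at *
    field_simp
  have hbot (s : ℝ) : Tendsto (fun u => -Real.log (Real.sigmoid (-(c * u + s))) / c) atBot (𝓝 0) := by
    have h1 : Tendsto (fun u : ℝ => -(c * u + s)) atBot atTop := by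
      refine tendsto_neg_atBot_atTop.comp ?_
      exact tendsto_atBot_add_const_right _ _ (tendsto_id.const_mul_atBot hc)
    have h2 := ((Real.tendsto_sigmoid_atTop.comp h1).log one_ne_zero).neg.div_const c
    simpa using h2
  have htop (s : ℝ) : Tendsto (fun u => -Real.log (Real.sigmoid (-(c * u + s))) / c - u) atTop
      (𝓝 (s / c)) := by
    have h1 : Tendsto (fun u : ℝ => c * u + s) atTop atTop :=
      tendsto_atTop_add_const_right _ _ (tendsto_id.const_mul_atTop hc)
    have h2 := (((Real.tendsto_sigmoid_atTop.comp h1).log one_ne_zero).neg.add_const s).div_const c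
    simp only [Real.log_one, neg_zero, zero_add] at h2
    refine h2.congr fun u => ?_
    simp only [Function.comp]
    rw [← Real.sigmoid_mul_rexp_neg, Real.log_mul (Real.sigmoid_pos _).ne' (Real.exp_pos _).ne',
      Real.log_exp]
    field_simp
    ring
  have hb := (hbot 0).sub (hbot s)
  have ht := (htop 0).sub (htop s)
  have := integral_of_hasDerivAt_of_tendsto (f' := sigmoidDiff c s) (fun u => by
    have := (hlog 0 u).sub (hlog s u)
    rwa [add_zero] at this) (integrable_sigmoidDiff hc hs) hb (ht.congr fun u => by
      ring)
  rw [this]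
  ring

lemma summable_inv_sinh {d : ℝ} (hd : 0 < d) :
    Summable fun n : ℕ => (Real.sinh (d * (n + 1)))⁻¹ := by
  have hgeo : Summable fun n : ℕ => (Real.sinh d)⁻¹ * Real.exp (-d) ^ n :=
    (summable_geometric_of_lt_one (Real.exp_pos _).le (by simpa using hd)).mul_left _
  have hs : 0 < Real.sinh d := Real.sinh_pos_iff.2 hd
  refine hgeo.of_nonneg_of_le (fun n => ?_) (fun n => ?_)
  · exact inv_nonneg.2 (Real.sinh_nonneg_iff.2 (by positivity))
  · rw [← Real.exp_nat_mul, show (n : ℝ) * -d = -(d * n) by ring, Real.exp_neg, ← mul_inv]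
    refine inv_anti₀ (mul_pos hs (Real.exp_pos _)) ?_
    rw [mul_add, mul_one, add_comm (d * n : ℝ), Real.sinh_add, ← Real.cosh_add_sinh (d * n), mul_add]
    have h1 : 0 ≤ Real.sinh (d * n) := Real.sinh_nonneg_iff.2 (by positivity)
    have h2 := (Real.sinh_lt_cosh d).le
    gcongr

lemma summable_fourier_sigmoidDiff {c : ℝ} (hc : 0 < c) {s : ℝ} (hs : s ≤ 0) :
    Summable fun n : ℤ => 𝓕 (fun u : ℝ => (sigmoidDiff c s u : ℂ)) n := by
  have hbound : Summable fun n : ℕ => 2 * (π / c) * (Real.sinh (2 * π ^ 2 / c * (n + 1)))⁻¹ :=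
    (summable_inv_sinh (by positivity)).mul_left _
  have key (n : ℕ) (ξ : ℝ) (hξ : |ξ| = n + 1) :
      ‖𝓕 (fun u : ℝ => (sigmoidDiff c s u : ℂ)) ξ‖ ≤
        2 * (π / c) * (Real.sinh (2 * π ^ 2 / c * (n + 1)))⁻¹ := by
    have hξ0 : ξ ≠ 0 := by
      rintro rfl
      rw [abs_zero] at hξ
      linarith [n.cast_nonneg (α := ℝ)]
    rw [fourier_sigmoidDiff hc hs hξ0, norm_mul, norm_mul, Complex.norm_I, one_mul,
      Complex.norm_real, norm_div, Real.norm_eq_abs (Real.sinh _), Real.abs_sinh, abs_div, abs_mul,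
      hξ, Real.norm_of_nonneg (by positivity : 0 ≤ π / c), abs_of_pos hc,
      abs_of_nonneg (by positivity : 0 ≤ 2 * π ^ 2), div_eq_mul_inv (π / c),
      mul_assoc (2 : ℝ) (π / c), show 2 * π ^ 2 * (n + 1 : ℝ) / c = 2 * π ^ 2 / c * (n + 1) by ring]
    refine mul_le_mul_of_nonneg_right ?_ (mul_nonneg (by positivity)
      (inv_nonneg.2 (Real.sinh_nonneg_iff.2 (by positivity))))
    refine (norm_sub_le _ _).trans_eq ?_
    rw [show (2 * π * ξ / c * s * Complex.I : ℂ) = ((2 * π * ξ / c * s : ℝ) : ℂ) * Complex.I by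
      push_cast; ring, Complex.norm_exp_ofReal_mul_I, norm_one]
    norm_num
  refine Summable.of_add_one_of_neg_add_one (hbound.of_norm_bounded fun n => key n _ ?_)
    (hbound.of_norm_bounded fun n => key n _ ?_)
  · push_cast
    exact abs_of_pos (by positivity)
  · push_cast
    rw [abs_neg]
    exact abs_of_pos (by positivity)

lemma fourier_sigmoidDiff_add_neg {c : ℝ} (hc : 0 < c) {s : ℝ} (hs : s ≤ 0) (n : ℕ) :
  𝓕 (fun u : ℝ => (sigmoidDiff c s u : ℂ)) ((n + 1 : ℤ) : ℝ) +
    𝓕 (fun u : ℝ => (sigmoidDiff c s u : ℂ)) ((-(n + 1) : ℤ) : ℝ) =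
    ((-(2 * π / c) * (Real.sin (2 * π * (n + 1) * (s / c)) /
      Real.sinh (2 * π ^ 2 * (n + 1) / c)) : ℝ) : ℂ) := by
  have hn : ((n : ℝ) + 1) ≠ 0 := by positivity
  push_cast
  rw [fourier_sigmoidDiff hc hs hn, fourier_sigmoidDiff hc hs (neg_ne_zero.2 hn)]
  rw [show 2 * π ^ 2 * (-(n + 1 : ℝ)) / c = -(2 * π ^ 2 * (n + 1) / c) by ring, Real.sinh_neg]
  rw [Complex.sin]
  push_cast
  rw [show (-(2 * π * (n + 1) * (s / c)) * Complex.I : ℂ) =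
    2 * π * -(n + 1) / c * s * Complex.I by ring, show (2 * π * (n + 1) * (s / c) * Complex.I : ℂ) =
    2 * π * (n + 1) / c * s * Complex.I by ring]
  ring

lemma tsum_sigmoidDiff {c : ℝ} (hc : 0 < c) {s : ℝ} (hs : s ≤ 0) :
    ∑' n : ℤ, sigmoidDiff c s n = -(s / c) - 2 * π / c *
      ∑' n : ℕ, Real.sin (2 * π * (n + 1) * (s / c)) / Real.sinh (2 * π ^ 2 * (n + 1) / c) := by
  have hF := summable_fourier_sigmoidDiff hc hs
  have hP := Real.tsum_eq_tsum_fourier_of_rpow_decay_of_summable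
    (f := fun u : ℝ => (sigmoidDiff c s u : ℂ))
    (Complex.continuous_ofReal.comp (continuous_sigmoidDiff c s)) one_lt_two
    (sigmoidDiff_isBigO hc hs) hF 0
  have hF1 : Summable fun n : ℕ => 𝓕 (fun u : ℝ => (sigmoidDiff c s u : ℂ)) ((n + 1 : ℤ) : ℝ) :=
    hF.comp_injective (i := fun n : ℕ => (n + 1 : ℤ)) (fun a b h => by simpa using h)
  have hF2 : Summable fun n : ℕ => 𝓕 (fun u : ℝ => (sigmoidDiff c s u : ℂ)) ((-(n + 1) : ℤ) : ℝ) :=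
    hF.comp_injective (i := fun n : ℕ => (-(n + 1) : ℤ)) (fun a b h => by simpa using h)
  have hF0 : 𝓕 (fun u : ℝ => (sigmoidDiff c s u : ℂ)) ((0 : ℤ) : ℝ) = ((-(s / c) : ℝ) : ℂ) := by
    rw [Real.fourier_eq', ← neg_div, ← integral_sigmoidDiff hc hs, ← integral_complex_ofReal]
    simp
  simp only [zero_add, QuotientAddGroup.mk_zero, fourier_eval_zero, mul_one] at hP
  rw [tsum_of_add_one_of_neg_add_one
    (f := fun n : ℤ => 𝓕 (fun u : ℝ => (sigmoidDiff c s u : ℂ)) n) hF1 hF2, hF0, add_right_comm, ← hF1.tsum_add hF2,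
    tsum_congr (fourier_sigmoidDiff_add_neg hc hs), ← Complex.ofReal_tsum, ← Complex.ofReal_tsum, tsum_mul_left,
    ← Complex.ofReal_add, Complex.ofReal_inj] at hP
  rw [hP]
  ring

lemma summable_sigmoid_neg_mul {c : ℝ} (hc : 0 < c) (s : ℝ) :
    Summable fun n : ℕ => Real.sigmoid (-(c * n) + s) := by
  have hgeo : Summable fun n : ℕ => Real.exp s * Real.exp (-c) ^ n :=
    (summable_geometric_of_lt_one (Real.exp_pos _).le (by simpa using hc)).mul_left _
  refine hgeo.of_nonneg_of_le (fun n => Real.sigmoid_nonneg _)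
    (fun n => (sigmoid_le_exp _).trans_eq ?_)
  rw [← Real.exp_nat_mul, ← Real.exp_add]
  ring_nf

lemma tsum_sigmoidDiff_eq_sub {c : ℝ} (hc : 0 < c) (s : ℝ) :
    ∑' n : ℤ, sigmoidDiff c s n = ∑' n : ℕ, Real.sigmoid (-(c * (n + 1)) - s) -
      ∑' n : ℕ, Real.sigmoid (-(c * n) + s) + 1 / 2 := by
  have h0 := summable_sigmoid_neg_mul hc 0
  have h1 := summable_sigmoid_neg_mul hc s
  have h2 := summable_sigmoid_neg_mul hc (-s)
  have h0' := (summable_nat_add_iff 1).2 h0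
  have h1' := (summable_nat_add_iff 1).2 h1
  have h2' := (summable_nat_add_iff 1).2 h2
  have ha : (fun n : ℕ => sigmoidDiff c s ((n + 1 : ℤ) : ℝ)) = fun n : ℕ =>
      Real.sigmoid (-(c * ((n + 1 : ℕ) : ℝ)) + -s) - Real.sigmoid (-(c * ((n + 1 : ℕ) : ℝ)) + 0) := by
    ext n
    rw [add_zero, Real.sigmoid_neg, ← neg_add, Real.sigmoid_neg, sigmoidDiff]
    push_cast
    ring
  have hb : (fun n : ℕ => sigmoidDiff c s ((-(n + 1) : ℤ) : ℝ)) = fun n : ℕ =>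
      Real.sigmoid (-(c * ((n + 1 : ℕ) : ℝ)) + 0) - Real.sigmoid (-(c * ((n + 1 : ℕ) : ℝ)) + s) := by
    ext n
    rw [sigmoidDiff]
    push_cast
    ring_nf
  rw [tsum_of_add_one_of_neg_add_one (f := fun n : ℤ => sigmoidDiff c s n)
    (by rw [ha]; exact h2'.sub h0') (by rw [hb]; exact h0'.sub h1'), ha, hb, h2'.tsum_sub h0',
    h0'.tsum_sub h1', h1.tsum_eq_zero_add]
  simp only [sigmoidDiff, Int.cast_zero, mul_zero, zero_add, Real.sigmoid_zero, Nat.cast_zero,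
    neg_zero, Nat.cast_add, Nat.cast_one, sub_eq_add_neg]
  ring

lemma sigmoid_neg_log_two_mul_sub {x : ℝ} (hx : 0 < x) (n : ℕ) :
    Real.sigmoid (-(Real.log 2 * (n + 1)) - Real.log x) = (1 + 2 ^ (n + 1) * x)⁻¹ := by
  rw [Real.sigmoid_def, show -(-(Real.log 2 * (n + 1)) - Real.log x) =
    ((n + 1 : ℕ) : ℝ) * Real.log 2 + Real.log x by push_cast; ring, Real.exp_add, Real.exp_nat_mul,
    Real.exp_log two_pos, Real.exp_log hx]

lemma sigmoid_neg_log_two_mul_add {x : ℝ} (hx : 0 < x) (n : ℕ) :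
    Real.sigmoid (-(Real.log 2 * n) + Real.log x) = x * (1 / 2) ^ n / (1 + x * (1 / 2) ^ n) := by
  rw [Real.sigmoid_def, show -(-(Real.log 2 * n) + Real.log x) =
    (n : ℝ) * Real.log 2 + -Real.log x by ring, Real.exp_add, Real.exp_nat_mul,
    Real.exp_log two_pos, Real.exp_neg, Real.exp_log hx, one_div, inv_pow]
  field_simp
  ring

lemma tsum_half_pow_div {x : ℝ} (hx : 0 < x) :
    ∑' k : ℕ, (1 / 2 : ℝ) ^ (k + 1) / (1 + 2 ^ (k + 1) * x) =
      1 - x * ∑' k : ℕ, Real.sigmoid (-(Real.log 2 * (k + 1)) - Real.log x) := by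
  have hsum : Summable fun k : ℕ => Real.sigmoid (-(Real.log 2 * (k + 1)) - Real.log x) := by
    simpa [sub_eq_add_neg] using (summable_nat_add_iff 1).2
      (summable_sigmoid_neg_mul (Real.log_pos one_lt_two) (-Real.log x))
  have hgeo : HasSum (fun k : ℕ => (1 / 2 : ℝ) ^ (k + 1)) 1 := by
    simpa [pow_succ] using hasSum_geometric_two.mul_right (1 / 2 : ℝ)
  rw [← tsum_mul_left]
  refine Eq.trans ?_ ((hgeo.summable.tsum_sub (hsum.mul_left x)).trans (by rw [hgeo.tsum_eq]))
  refine tsum_congr fun k => ?_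
  rw [sigmoid_neg_log_two_mul_sub hx, one_div, inv_pow]
  have : (0 : ℝ) < 1 + 2 ^ (k + 1) * x := by positivity
  field_simp
  ring

lemma tsum_power_series_eq {x : ℝ} (hx0 : 0 < x) (hx1 : x < 1) :
    ∑' n : ℕ, (-1 : ℝ) ^ (n + 2) * x ^ (n + 2) / ((1 / 2 : ℝ) ^ (n + 1) - 1) =
      -(x * ∑' j : ℕ, Real.sigmoid (-(Real.log 2 * j) + Real.log x)) := by
  have hrow (n : ℕ) : HasSum (fun j : ℕ => (-1 : ℝ) ^ n * x ^ (n + 2) * ((1 / 2) ^ j) ^ (n + 1))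
      (-((-1 : ℝ) ^ (n + 2) * x ^ (n + 2) / ((1 / 2 : ℝ) ^ (n + 1) - 1))) := by
    have hlt : (1 / 2 : ℝ) ^ (n + 1) < 1 := pow_lt_one₀ (by norm_num) (by norm_num) n.succ_ne_zero
    convert! (hasSum_geometric_of_lt_one (by positivity) hlt).mul_left ((-1 : ℝ) ^ n * x ^ (n + 2))
      using 1
    · ext j
      rw [← pow_mul, ← pow_mul, mul_comm j]
    · rw [← div_eq_mul_inv, ← div_neg, neg_sub, pow_add (-1 : ℝ) n 2, neg_one_sq, mul_one]
  have hcol (j : ℕ) : HasSum (fun n : ℕ => (-1 : ℝ) ^ n * x ^ (n + 2) * ((1 / 2) ^ j) ^ (n + 1))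
      (x * Real.sigmoid (-(Real.log 2 * j) + Real.log x)) := by
    have hq1 : ((1 / 2 : ℝ)) ^ j ≤ 1 := pow_le_one₀ (by norm_num) (by norm_num)
    have hlt : ‖-(x * (1 / 2) ^ j)‖ < 1 := by
      rw [norm_neg, Real.norm_of_nonneg (by positivity)]
      exact (mul_le_of_le_one_right hx0.le hq1).trans_lt hx1
    rw [sigmoid_neg_log_two_mul_add hx0]
    convert! (hasSum_geometric_of_norm_lt_one hlt).mul_left (x ^ 2 * (1 / 2) ^ j) using 1
    · ext n
      rw [neg_pow (x * (1 / 2) ^ j), mul_pow]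
      ring
    · rw [sub_neg_eq_add]
      ring
  have hsum : Summable (Function.uncurry fun n j : ℕ =>
      (-1 : ℝ) ^ n * x ^ (n + 2) * ((1 / 2) ^ j) ^ (n + 1)) := by
    have hprod : Summable fun p : ℕ × ℕ => x ^ p.1 * (1 / 2 : ℝ) ^ p.2 :=
      (summable_geometric_of_lt_one hx0.le hx1).mul_of_nonneg summable_geometric_two
        (fun n => by positivity) (fun j => by positivity)
    refine hprod.of_norm_bounded fun p => ?_
    have hq1 : ((1 / 2 : ℝ)) ^ p.2 ≤ 1 := pow_le_one₀ (by norm_num) (by norm_num)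
    simp only [Function.uncurry, norm_mul, norm_pow, norm_neg, norm_one, one_pow, one_mul,
      Real.norm_of_nonneg hx0.le, Real.norm_of_nonneg (by norm_num : (0 : ℝ) ≤ 1 / 2)]
    exact mul_le_mul (pow_le_pow_of_le_one hx0.le hx1.le (by lia))
      (pow_le_of_le_one (by positivity) hq1 (by lia)) (by positivity) (by positivity)
  rw [← neg_eq_iff_eq_neg, ← tsum_neg, ← tsum_mul_left]
  calc _ = ∑' n : ℕ, ∑' j : ℕ, (-1 : ℝ) ^ n * x ^ (n + 2) * ((1 / 2) ^ j) ^ (n + 1) :=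
        tsum_congr fun n => (hrow n).tsum_eq.symm
    _ = _ := hsum.tsum_comm.symm
    _ = _ := tsum_congr fun j => (hcol j).tsum_eq

/-- The corrected expansion of `D₁(x) = Σ_{k≥1} 2^{−k}/(1 + 2^k x)` for
`0 < x < 1`, including the periodic term `x·P(log₂ x)` omitted in error in
Lemma 3.1 of Brent 1976:
`D₁(x) = 1 + x log₂ x + x/2 + x P(log₂ x) + Σ_{n≥2} (−1)ⁿ xⁿ/(2^{1−n} − 1)`. -/
theorem D1_expansion (x : ℝ) (hx0 : 0 < x) (hx1 : x < 1) :
    ∑' k : ℕ, (1 / 2 : ℝ) ^ (k + 1) / (1 + 2 ^ (k + 1) * x)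
      = 1 + x * Real.logb 2 x + x / 2 + x * mellinP (Real.logb 2 x) +
        ∑' n : ℕ, (-1 : ℝ) ^ (n + 2) * x ^ (n + 2) / ((1 / 2 : ℝ) ^ (n + 1) - 1) := by
  have hc : 0 < Real.log 2 := Real.log_pos one_lt_two
  have hs : Real.log x ≤ 0 := Real.log_nonpos hx0.le hx1.le
  have h := (tsum_sigmoidDiff_eq_sub hc (Real.log x)).symm.trans (tsum_sigmoidDiff hc hs)
  rw [tsum_half_pow_div hx0, tsum_power_series_eq hx0 hx1, mellinP, Real.logb]
  linear_combination (-x) * h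
end
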